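/- Let N ≥ 1, let A be a constant N×N complex matrix, and let B : ℝ → (N×2 complex matrices) and 𝕏 : ℝ → (N×N complex matrices) be continuously differentiable, with 𝕏(x) Hermitian and invertible for all x, satisfying for all x: (i) d/dx (B σ₁) + A B σ₂ + B γ = 0; (ii) A 𝕏 + 𝕏 A* + B σ₁ B* = 0; (iii) d𝕏/dx = B σ₂ B*. Define γ_*(x) := γ + σ₂ B(x)* 𝕏(x)⁻¹ B(x) σ₁ − σ₁ B(x)* 𝕏(x)⁻¹ B(x) σ₂ and, for λ not an eigenvalue of A, S(λ,x) := I₂ − B(x)* 𝕏(x)⁻¹ (λ Iₙ − A)⁻¹ B(x) σ₁. If u : ℝ → ℂ² is differentiable and satisfies the input equation λ σ₂ u(x) − σ₁ u'(x) + γ u(x) = 0 for all x, then y(x) := S(λ,x) u(x) satisfies the output equation λ σ₂ y(x) − σ₁ y'(x) + γ_*(x) y(x) = 0 for all x. -/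

import Mathlib

open Matrix Complex

noncomputable section

/-- The fixed 2×2 matrix σ₁ = [[0,1],[1,0]]. -/
def sigma1 : Matrix (Fin 2) (Fin 2) ℂ := !![0, 1; 1, 0]

/-- The fixed 2×2 matrix σ₂ = [[1,0],[0,0]]. -/
def sigma2 : Matrix (Fin 2) (Fin 2) ℂ := !![1, 0; 0, 0]

/-- The fixed 2×2 matrix γ = [[0,0],[0,i]]. -/
def gammaM : Matrix (Fin 2) (Fin 2) ℂ := !![0, 0; 0, Complex.I]

attribute [local instance] Matrix.normedAddCommGroup Matrix.normedSpace

theorem hasDerivAt_matrix_iff' {m n : Type*} [Fintype m] [Fintype n]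
    {M : ℝ → Matrix m n ℂ} {M' : Matrix m n ℂ} {x : ℝ} :
    HasDerivAt M M' x ↔ ∀ i j, HasDerivAt (fun t => M t i j) (M' i j) x := by
  have h1 : HasDerivAt M M' x ↔ ∀ i, HasDerivAt (fun t => M t i) (M' i) x :=
    hasDerivAt_pi (φ := fun t i => M t i) (φ' := fun i => M' i)
  rw [h1]
  exact forall_congr' fun i => hasDerivAt_pi (φ := fun t j => M t i j) (φ' := fun j => M' i j)

theorem hasDerivAt_matrix_mul' {m n p : Type*} [Fintype m] [Fintype n] [Fintype p]
    {M : ℝ → Matrix m n ℂ} {M' : Matrix m n ℂ} {K : ℝ → Matrix n p ℂ} {K' : Matrix n p ℂ} {x : ℝ}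
    (hM : HasDerivAt M M' x) (hK : HasDerivAt K K' x) :
    HasDerivAt (fun t => M t * K t) (M' * K x + M x * K') x := by
  rw [hasDerivAt_matrix_iff'] at *
  intro i j
  simp only [Matrix.mul_apply, Matrix.add_apply, ← Finset.sum_add_distrib]
  exact HasDerivAt.fun_sum fun k _ => (hM i k).mul (hK k j)

theorem hasDerivAt_matrix_mulVec' {m n : Type*} [Fintype m] [Fintype n]
    {M : ℝ → Matrix m n ℂ} {M' : Matrix m n ℂ} {v : ℝ → n → ℂ} {v' : n → ℂ} {x : ℝ}
    (hM : HasDerivAt M M' x) (hv : HasDerivAt v v' x) :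
    HasDerivAt (fun t => M t *ᵥ v t) (M' *ᵥ v x + M x *ᵥ v') x := by
  rw [hasDerivAt_matrix_iff'] at hM
  rw [hasDerivAt_pi] at *
  intro i
  simp only [Matrix.mulVec, dotProduct, Pi.add_apply, ← Finset.sum_add_distrib]
  exact HasDerivAt.fun_sum fun k _ => (hM i k).mul (hv k)

theorem hasDerivAt_matrix_conjTranspose' {m n : Type*} [Fintype m] [Fintype n]
    {M : ℝ → Matrix m n ℂ} {M' : Matrix m n ℂ} {x : ℝ}
    (hM : HasDerivAt M M' x) : HasDerivAt (fun t => (M t)ᴴ) (M'ᴴ) x := by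
  rw [hasDerivAt_matrix_iff'] at *
  intro i j
  exact (hM j i).star

theorem hasDerivAt_matrix_inv' {n : Type*} [Fintype n] [DecidableEq n]
    {M : ℝ → Matrix n n ℂ} {M' : Matrix n n ℂ} {x : ℝ}
    (hM : HasDerivAt M M' x) (hu : ∀ t, IsUnit (M t)) :
    HasDerivAt (fun t => (M t)⁻¹) (-((M x)⁻¹ * M' * (M x)⁻¹)) x := by
  have hd : ∀ t, IsUnit (M t).det := fun t => (Matrix.isUnit_iff_isUnit_det _).1 (hu t)
  have hc : ContinuousAt (fun t => (M t)⁻¹) x := by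
    have h0 : ContinuousAt (Inv.inv : Matrix n n ℂ → Matrix n n ℂ) (M x) := by
      apply continuousAt_matrix_inv
      rw [Ring.inverse_eq_inv']
      exact continuousAt_inv₀ (hd x).ne_zero
    exact ContinuousAt.comp (f := M) h0 hM.continuousAt
  have hM2 : Filter.Tendsto (fun t => (t - x)⁻¹ • (M t - M x)) (nhdsWithin x {x}ᶜ) (nhds M') :=
    hasDerivAt_iff_tendsto_slope.1 hM
  have hc' : Filter.Tendsto (fun t => (M t)⁻¹) (nhdsWithin x {x}ᶜ) (nhds (M x)⁻¹) :=
    hc.tendsto.mono_left nhdsWithin_le_nhds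
  have key : Filter.Tendsto (fun t => (t - x)⁻¹ • ((M t)⁻¹ - (M x)⁻¹)) (nhdsWithin x {x}ᶜ)
      (nhds (-((M x)⁻¹ * M' * (M x)⁻¹))) := by
    have := ((hc'.mul hM2).mul (tendsto_const_nhds (x := (M x)⁻¹))).neg
    refine this.congr fun t => ?_
    simp only [Matrix.mul_smul, Matrix.smul_mul, Matrix.mul_sub, Matrix.sub_mul]
    rw [Matrix.nonsing_inv_mul _ (hd t), Matrix.mul_assoc _ (M x), Matrix.mul_nonsing_inv _ (hd x)]
    simp only [← smul_neg, Matrix.one_mul, Matrix.mul_one, neg_sub]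
  exact hasDerivAt_iff_tendsto_slope.2 key

theorem hasDerivAt_matrix_const' {m n : Type*} [Fintype m] [Fintype n]
    (x : ℝ) (M : Matrix m n ℂ) : HasDerivAt (fun _ : ℝ => M) 0 x := by
  rw [hasDerivAt_matrix_iff']
  exact fun i j => hasDerivAt_const x (M i j)

theorem hasDerivAt_matrix_const_sub' {m n : Type*} [Fintype m] [Fintype n]
    {M : ℝ → Matrix m n ℂ} {M' : Matrix m n ℂ} {x : ℝ} (K : Matrix m n ℂ)
    (hM : HasDerivAt M M' x) : HasDerivAt (fun t => K - M t) (-M') x := by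
  rw [hasDerivAt_matrix_iff'] at *
  exact fun i j => (hM i j).const_sub (K i j)

theorem sigma1_sq : sigma1 * sigma1 = 1 := by
  ext i j; fin_cases i <;> fin_cases j <;> simp [sigma1]

theorem sigma1_herm : sigma1ᴴ = sigma1 := by
  ext i j; fin_cases i <;> fin_cases j <;> simp [sigma1]

theorem sigma2_herm : sigma2ᴴ = sigma2 := by
  ext i j; fin_cases i <;> fin_cases j <;> simp [sigma2]

theorem gammaM_herm : gammaMᴴ = -gammaM := by
  ext i j; fin_cases i <;> fin_cases j <;> simp [gammaM]

/-- multiplication by the transfer function `S(λ,x)` maps solutions of the input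
equation `λσ₂u − σ₁u' + γu = 0` to solutions of the output equation `λσ₂y − σ₁y' + γ_*y = 0`. -/
theorem transfer_function_maps_input_to_output (N : ℕ) (hN : 1 ≤ N)
    (A : Matrix (Fin N) (Fin N) ℂ)
    (B : ℝ → Matrix (Fin N) (Fin 2) ℂ)
    (X : ℝ → Matrix (Fin N) (Fin N) ℂ)
    (hBsmooth : ContDiff ℝ 1 B) (hXsmooth : ContDiff ℝ 1 X)
    (hherm : ∀ x, (X x).IsHermitian) (hinv : ∀ x, IsUnit (X x))
    (h1 : ∀ x, HasDerivAt (fun x' => B x' * sigma1)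
      (-(A * B x * sigma2 + B x * gammaM)) x)
    (h2 : ∀ x, A * X x + X x * Aᴴ + B x * sigma1 * (B x)ᴴ = 0)
    (h3 : ∀ x, HasDerivAt X (B x * sigma2 * (B x)ᴴ) x)
    (gammaStar : ℝ → Matrix (Fin 2) (Fin 2) ℂ)
    (hgs : ∀ x, gammaStar x = gammaM + sigma2 * (B x)ᴴ * (X x)⁻¹ * B x * sigma1
      - sigma1 * (B x)ᴴ * (X x)⁻¹ * B x * sigma2)
    (l : ℂ) (hl : IsUnit (l • (1 : Matrix (Fin N) (Fin N) ℂ) - A))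
    (S : ℝ → Matrix (Fin 2) (Fin 2) ℂ)
    (hS : ∀ x, S x =
      1 - (B x)ᴴ * (X x)⁻¹ * (l • (1 : Matrix (Fin N) (Fin N) ℂ) - A)⁻¹ * B x * sigma1)
    (u : ℝ → Fin 2 → ℂ) (hu : Differentiable ℝ u)
    (hueq : ∀ x, l • sigma2.mulVec (u x) - sigma1.mulVec (deriv u x) + gammaM.mulVec (u x) = 0)
    (y : ℝ → Fin 2 → ℂ) (hy : ∀ x, y x = (S x).mulVec (u x)) :
    ∀ x, l • sigma2.mulVec (y x) - sigma1.mulVec (deriv y x) + (gammaStar x).mulVec (y x) = 0 := by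
  intro x
  have hXd : IsUnit (X x).det := (Matrix.isUnit_iff_isUnit_det _).1 (hinv x)
  have hld := (Matrix.isUnit_iff_isUnit_det _).1 hl
  set R := (l • (1 : Matrix (Fin N) (Fin N) ℂ) - A)⁻¹ with hR
  have hRA : R * A = l • R - 1 := by
    have := Matrix.nonsing_inv_mul _ hld
    rw [← hR, Matrix.mul_sub, Matrix.mul_smul, Matrix.mul_one] at this
    rw [← this]; abel
  have hAR : A * R = l • R - 1 := by
    have := Matrix.mul_nonsing_inv _ hld
    rw [← hR, Matrix.sub_mul, Matrix.smul_mul, Matrix.one_mul] at this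
    rw [← this]; abel
  -- derivative of `B*`, multiplied by `σ₁`
  have hBs : HasDerivAt (fun t => sigma1 * (B t)ᴴ)
      (-(sigma2 * (B x)ᴴ * Aᴴ) + gammaM * (B x)ᴴ) x := by
    have := hasDerivAt_matrix_conjTranspose' (h1 x)
    simp only [Matrix.conjTranspose_mul, Matrix.conjTranspose_neg, Matrix.conjTranspose_add,
      sigma1_herm, sigma2_herm, gammaM_herm] at this
    convert this using 1
    rw [Matrix.neg_mul, Matrix.mul_assoc]
    abel
  have hXi := hasDerivAt_matrix_inv' (h3 x) hinv
  set C := (B x)ᴴ * (X x)⁻¹ with hC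
  have hAX : Aᴴ * (X x)⁻¹ = -((X x)⁻¹ * A) - (X x)⁻¹ * B x * sigma1 * C := by
    have h := congrArg (fun Z => (X x)⁻¹ * Z * (X x)⁻¹) (h2 x)
    simp only [Matrix.mul_add, Matrix.add_mul, Matrix.mul_zero, Matrix.zero_mul] at h
    have e1 : (X x)⁻¹ * (A * X x) * (X x)⁻¹ = (X x)⁻¹ * A := by
      rw [Matrix.mul_assoc, Matrix.mul_assoc, Matrix.mul_nonsing_inv _ hXd, Matrix.mul_one]
    have e2 : (X x)⁻¹ * (X x * Aᴴ) * (X x)⁻¹ = Aᴴ * (X x)⁻¹ := by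
      rw [← Matrix.mul_assoc, Matrix.nonsing_inv_mul _ hXd, Matrix.one_mul]
    rw [e1, e2] at h
    have e3 : (X x)⁻¹ * (B x * sigma1 * (B x)ᴴ) * (X x)⁻¹ = (X x)⁻¹ * B x * sigma1 * C := by
      simp only [hC, Matrix.mul_assoc]
    rw [e3] at h
    linear_combination (norm := abel_nf) h
  have hsC : HasDerivAt (fun t => sigma1 * (B t)ᴴ * (X t)⁻¹)
      (sigma2 * C * A + gammaStar x * C) x := by
    convert hasDerivAt_matrix_mul' hBs hXi using 1
    rw [Matrix.add_mul, Matrix.neg_mul, Matrix.mul_assoc _ Aᴴ, hAX, hgs]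
    simp only [hC, Matrix.mul_assoc, Matrix.mul_add, Matrix.add_mul, Matrix.mul_sub,
      Matrix.sub_mul, Matrix.mul_neg, Matrix.neg_mul]
    abel
  have hsS : HasDerivAt (fun t => sigma1 * S t)
      (-((sigma2 * C * A + gammaStar x * C) * (R * (B x * sigma1))
        - sigma1 * C * (R * (A * B x * sigma2 + B x * gammaM)))) x := by
    have hk := hasDerivAt_matrix_mul' (hasDerivAt_matrix_const' x R) (h1 x)
    have := hasDerivAt_matrix_const_sub' sigma1 (hasDerivAt_matrix_mul' hsC hk)
    convert this using 1
    · funext t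
      rw [hS]
      simp only [Matrix.mul_assoc, Matrix.mul_sub, Matrix.mul_one]
    · simp only [hC, Matrix.mul_assoc, Matrix.mul_neg, Matrix.zero_mul, zero_add]
      abel
  have hsy := hasDerivAt_matrix_mulVec' hsS (hu x).hasDerivAt
  have hyeq : y = fun t => sigma1 *ᵥ ((sigma1 * S t) *ᵥ u t) := by
    funext t
    rw [hy, Matrix.mulVec_mulVec, ← Matrix.mul_assoc, sigma1_sq, Matrix.one_mul]
  have hyd := hasDerivAt_matrix_mulVec' (hasDerivAt_matrix_const' x sigma1) hsy
  rw [← hyeq] at hyd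
  have hud : deriv u x = (sigma1 * (l • sigma2 + gammaM)) *ᵥ u x := by
    have h := hueq x
    have : sigma1 *ᵥ deriv u x = (l • sigma2 + gammaM) *ᵥ u x := by
      rw [Matrix.add_mulVec, Matrix.smul_mulVec]
      linear_combination (norm := abel_nf) -h
    rw [← Matrix.mulVec_mulVec, ← this, Matrix.mulVec_mulVec, sigma1_sq, Matrix.one_mulVec]
  rw [hyd.deriv, hud, hy]
  simp only [Matrix.zero_mulVec, zero_add, Matrix.mulVec_mulVec, Matrix.mulVec_add,
    ← Matrix.smul_mulVec, ← Matrix.add_mulVec, ← Matrix.sub_mulVec]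
  convert Matrix.zero_mulVec (u x) using 2
  have s1 : ∀ {p : ℕ} (Z : Matrix (Fin 2) (Fin p) ℂ), sigma1 * (sigma1 * Z) = Z := by
    intro p Z
    rw [← Matrix.mul_assoc, sigma1_sq, Matrix.one_mul]
  have r1 : ∀ {p : ℕ} (Z : Matrix (Fin N) (Fin p) ℂ), R * (A * Z) = l • (R * Z) - Z := by
    intro p Z
    rw [← Matrix.mul_assoc, hRA, Matrix.sub_mul, Matrix.smul_mul, Matrix.one_mul]
  have r2 : ∀ {p : ℕ} (Z : Matrix (Fin N) (Fin p) ℂ), A * (R * Z) = l • (R * Z) - Z := by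
    intro p Z
    rw [← Matrix.mul_assoc, hAR, Matrix.sub_mul, Matrix.smul_mul, Matrix.one_mul]
  have hg : gammaStar x = gammaM + sigma2 * (C * (B x * sigma1))
      - sigma1 * (C * (B x * sigma2)) := by
    rw [hgs]; simp only [hC, Matrix.mul_assoc]
  have hSx : S x = 1 - C * (R * (B x * sigma1)) := by
    rw [hS]; simp only [hC, Matrix.mul_assoc]
  rw [hSx]
  clear_value C R
  simp only [Matrix.mul_assoc, Matrix.mul_add, Matrix.add_mul, Matrix.mul_sub,
      Matrix.sub_mul, Matrix.mul_neg, Matrix.neg_mul, s1, r1, r2, Matrix.mul_smul,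
      Matrix.smul_mul, smul_sub, smul_add, Matrix.mul_one, Matrix.one_mul, Matrix.zero_mul, Matrix.mul_zero]
  rw [hg]
  simp only [Matrix.mul_assoc, Matrix.add_mul, Matrix.sub_mul]
  abel


end
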